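/- Let (γ,ν) and (γ̄,ν̄) : I → ℝ² × S¹ be Legendre curves with curvatures (ℓ,β) and (ℓ̄,β̄), which are (v,w̄)-mates with v = cos θ ν + sin θ μ and w̄ = cos τ ν̄ + sin τ μ̄ for smooth θ, τ : I → ℝ. Suppose moreover that γ and γ̄ are regular plane curves (so β and β̄ are nowhere zero). Then γ and γ̄ are (v,w̄)-regular mates, where v = sign(β)(cos(θ − π/2) t + sin(θ − π/2) n) and w̄ = sign(β̄)(cos(τ − π/2) t̄ + sin(τ − π/2) n̄), with (t,n) and (t̄,n̄) the Frenet frames of γ and γ̄ and sign(β) = 1 if β > 0, −1 if β < 0. -/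

import Mathlib

open Real

noncomputable section

/-- Euclidean dot product on the plane `ℝ × ℝ`. -/
def dot (a b : ℝ × ℝ) : ℝ := a.1 * b.1 + a.2 * b.2

/-- `J`, the anticlockwise rotation by `π/2` on the plane: `J(a₁,a₂) = (−a₂,a₁)`. -/
def Jrot (a : ℝ × ℝ) : ℝ × ℝ := (-a.2, a.1)

/-- `λ ≢ 0` on `I`: the set `{t ∈ I | λ t ≠ 0}` is dense in `I`. -/
def NotIdentZero (I : Set ℝ) (lam : ℝ → ℝ) : Prop :=
  I ⊆ closure {t | t ∈ I ∧ lam t ≠ 0}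

/-- The unit tangent `γ̇/|γ̇|` of a plane curve (Euclidean norm). -/
def utang (γ : ℝ → ℝ × ℝ) (s : ℝ) : ℝ × ℝ :=
  (Real.sqrt (dot (deriv γ s) (deriv γ s)))⁻¹ • deriv γ s

/-- A Legendre curve on `I`: smooth `(γ,ν)` with `ν` unit and `γ̇·ν = 0` on `I`. -/
def IsLegendre (I : Set ℝ) (γ ν : ℝ → ℝ × ℝ) : Prop :=
  ContDiff ℝ (⊤ : ℕ∞) γ ∧ ContDiff ℝ (⊤ : ℕ∞) ν ∧ (∀ t ∈ I, dot (ν t) (ν t) = 1) ∧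
  (∀ t ∈ I, dot (deriv γ t) (ν t) = 0)

/-- The first component `ℓ = ν̇·μ` of the Legendre curvature, with `μ = J∘ν`. -/
def legL (ν : ℝ → ℝ × ℝ) (t : ℝ) : ℝ := dot (deriv ν t) (Jrot (ν t))

/-- The second component `β = γ̇·μ` of the Legendre curvature, with `μ = J∘ν`. -/
def legB (γ ν : ℝ → ℝ × ℝ) (t : ℝ) : ℝ := dot (deriv γ t) (Jrot (ν t))

/-- The sign function taking values `±1`: `sgn x = 1` if `x > 0` and `−1` if `x < 0`. -/
def sgn (x : ℝ) : ℝ := if 0 < x then 1 else -1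

lemma deriv_eq_legB_smul {I : Set ℝ} {γ ν : ℝ → ℝ × ℝ} (h : IsLegendre I γ ν) {t : ℝ}
    (ht : t ∈ I) : deriv γ t = legB γ ν t • Jrot (ν t) := by
  have h1 := h.2.2.1 t ht
  have h2 := h.2.2.2 t ht
  simp only [dot] at h1 h2
  ext
  · simp only [legB, dot, Jrot, Prod.smul_fst, smul_eq_mul]
    linear_combination -(deriv γ t).1 * h1 + (ν t).1 * h2
  · simp only [legB, dot, Jrot, Prod.smul_snd, smul_eq_mul]
    linear_combination -(deriv γ t).2 * h1 + (ν t).2 * h2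

lemma abs_inv_mul_self_eq_sgn {x : ℝ} (hx : x ≠ 0) : |x|⁻¹ * x = sgn x := by
  unfold sgn
  split_ifs with h
  · rw [abs_of_pos h, inv_mul_cancel₀ hx]
  · rw [abs_of_nonpos (not_lt.mp h), inv_neg, neg_mul, inv_mul_cancel₀ hx]

lemma sgn_mul_self (x : ℝ) : sgn x * sgn x = 1 := by
  unfold sgn
  split_ifs <;> norm_num

lemma utang_eq_sgn_smul {I : Set ℝ} {γ ν : ℝ → ℝ × ℝ} (h : IsLegendre I γ ν) {t : ℝ}
    (ht : t ∈ I) (hreg : deriv γ t ≠ 0) : utang γ t = sgn (legB γ ν t) • Jrot (ν t) := by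
  have hd := deriv_eq_legB_smul h ht
  have hβ : legB γ ν t ≠ 0 := fun h0 => hreg (by rw [hd, h0, zero_smul])
  have hnorm : dot (deriv γ t) (deriv γ t) = legB γ ν t ^ 2 := by
    have h1 := h.2.2.1 t ht
    rw [hd]
    simp only [dot, Jrot, Prod.smul_fst, Prod.smul_snd, smul_eq_mul] at h1 ⊢
    linear_combination legB γ ν t ^ 2 * h1
  rw [utang, hnorm, Real.sqrt_sq_eq_abs, hd, smul_smul, abs_inv_mul_self_eq_sgn hβ]

/-- A direction at angle `φ` to the Legendre frame `(ν, Jν)` is at angle `φ - π/2` to the Frenet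
frame, up to the sign of `β`. -/
lemma legendre_frame_eq_frenet_frame {I : Set ℝ} {γ ν : ℝ → ℝ × ℝ} (h : IsLegendre I γ ν) {t : ℝ}
    (ht : t ∈ I) (hreg : deriv γ t ≠ 0) (φ : ℝ) :
    cos φ • ν t + sin φ • Jrot (ν t) = sgn (legB γ ν t) •
      (cos (φ - π/2) • utang γ t + sin (φ - π/2) • Jrot (utang γ t)) := by
  have hs := sgn_mul_self (legB γ ν t)
  rw [utang_eq_sgn_smul h ht hreg, cos_sub_pi_div_two, sin_sub_pi_div_two]
  ext
  · simp only [Jrot, Prod.fst_add, Prod.smul_fst, Prod.smul_snd, smul_eq_mul]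
    linear_combination (sin φ * (ν t).2 - cos φ * (ν t).1) * hs
  · simp only [Jrot, Prod.snd_add, Prod.smul_fst, Prod.smul_snd, smul_eq_mul]
    linear_combination (-sin φ * (ν t).1 - cos φ * (ν t).2) * hs

/-- **Proposition 4.5 (1).** If Legendre curves `(γ,ν)` and `(γ̄,ν̄)` with curvatures
`(ℓ,β)` and `(ℓ̄,β̄)` are `(v,w̄)`-mates (with `v = cos θ ν + sin θ μ`,
`w̄ = cos τ ν̄ + sin τ μ̄`) and `γ`, `γ̄` are regular curves, then `γ` and `γ̄` are
`(v,w̄)`-regular mates, with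
`v = sign(β)(cos(θ−π/2) t + sin(θ−π/2) n)` and
`w̄ = sign(β̄)(cos(τ−π/2) t̄ + sin(τ−π/2) n̄)`. -/
theorem legendre_mates_to_regular_mates
    (I : Set ℝ) (hI : I.OrdConnected)
    (γ ν γb νb v w : ℝ → ℝ × ℝ) (lam θ τ : ℝ → ℝ)
    (hL : IsLegendre I γ ν) (hLb : IsLegendre I γb νb)
    (hθ : ContDiff ℝ (⊤ : ℕ∞) θ) (hτ : ContDiff ℝ (⊤ : ℕ∞) τ) (hlam : ContDiff ℝ (⊤ : ℕ∞) lam)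
    (hne : NotIdentZero I lam)
    (hvdef : ∀ t ∈ I, v t = cos (θ t) • ν t + sin (θ t) • Jrot (ν t))
    (hwdef : ∀ t ∈ I, w t = cos (τ t) • νb t + sin (τ t) • Jrot (νb t))
    (hmate : ∀ t ∈ I, γb t = γ t + lam t • v t)
    (hvw : ∀ t ∈ I, v t = w t)
    (hreg : ∀ t ∈ I, deriv γ t ≠ 0) (hregb : ∀ t ∈ I, deriv γb t ≠ 0) :
    (∀ t ∈ I, γb t = γ t + lam t • v t) ∧ (∀ t ∈ I, v t = w t) ∧
    (∀ t ∈ I, v t = sgn (legB γ ν t) •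
        (cos (θ t - π/2) • utang γ t + sin (θ t - π/2) • Jrot (utang γ t))) ∧
    (∀ t ∈ I, w t = sgn (legB γb νb t) •
        (cos (τ t - π/2) • utang γb t + sin (τ t - π/2) • Jrot (utang γb t))) := by
  refine ⟨hmate, hvw, fun t ht => ?_, fun t ht => ?_⟩
  · rw [hvdef t ht, legendre_frame_eq_frenet_frame hL ht (hreg t ht)]
  · rw [hwdef t ht, legendre_frame_eq_frenet_frame hLb ht (hregb t ht)]
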